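/- Let k ≥ 1 be an integer, R > 0, and let x ∈ ℝ^{k+1} be a fixed point with 0 < |x| and |x| ≠ R. Then the real function F(λ) = ∫_{S^k(R)} ω(x,y)^λ dS_y (λ ∈ ℝ) is strictly convex, satisfies the symmetry F(λ) = F(k − λ) for all λ ∈ ℝ, and attains its unique global minimum at λ = k/2; in particular its second derivative F″(λ) = ∫_{S^k(R)} ω(x,y)^λ (ln ω(x,y))² dS_y is strictly positive for every λ ∈ ℝ. -/

import Mathlib

open MeasureTheory

/-- The spherical ratio `ω(x,y) = |‖x‖² − R²| / ‖x − y‖²`. -/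
noncomputable def sRatio {n : ℕ} (R : ℝ) (x y : EuclideanSpace ℝ (Fin n)) : ℝ :=
  |‖x‖ ^ 2 - R ^ 2| / ‖x - y‖ ^ 2

/-- Radial projection onto the sphere of radius `R` is Lipschitz outside the open unit ball. -/
theorem norm_radial_sub_le {E : Type*} [NormedAddCommGroup E] [NormedSpace ℝ E] {R : ℝ}
    (hR : 0 ≤ R) {y z : E} (hy : 1 ≤ ‖y‖) (hz : 1 ≤ ‖z‖) :
    ‖(R / ‖y‖) • y - (R / ‖z‖) • z‖ ≤ 2 * R * ‖y - z‖ := by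
  have hy0 : 0 < ‖y‖ := by linarith
  have hz0 : 0 < ‖z‖ := by linarith
  have key : (R / ‖y‖) • y - (R / ‖z‖) • z
      = (R / ‖y‖) • (y - z) + (R / ‖y‖ - R / ‖z‖) • z := by
    rw [smul_sub, sub_smul]; abel
  have h1 : ‖(R / ‖y‖) • (y - z)‖ ≤ R * ‖y - z‖ := by
    rw [norm_smul, Real.norm_of_nonneg (by positivity)]
    gcongr
    exact div_le_self hR hy
  have h2 : ‖(R / ‖y‖ - R / ‖z‖) • z‖ ≤ R * ‖y - z‖ := by
    have : (R / ‖y‖ - R / ‖z‖) = (R / ‖y‖ * (‖z‖ - ‖y‖)) / ‖z‖ := by field_simp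
    rw [norm_smul, this, norm_div, norm_norm, div_mul_cancel₀ _ hz0.ne', norm_mul,
      Real.norm_of_nonneg (by positivity : 0 ≤ R / ‖y‖), norm_sub_rev y z]
    gcongr
    · exact div_le_self hR hy
    · exact abs_norm_sub_norm_le z y
  rw [key]
  calc _ ≤ _ := norm_add_le _ _
    _ ≤ R * ‖y - z‖ + R * ‖y - z‖ := add_le_add h1 h2
    _ = _ := by ring

theorem lipschitzWith_insertNth {k : ℕ} (i : Fin (k + 1)) (s : ℝ) :
    LipschitzWith 1 (fun v : Fin k → ℝ => i.insertNth (α := fun _ => ℝ) s v) := by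
  refine LipschitzWith.of_dist_le_mul fun v w => ?_
  rw [NNReal.coe_one, one_mul, dist_pi_le_iff dist_nonneg]
  intro j
  refine Fin.succAboveCases i ?_ (fun j => ?_) j
  · simp
  · simpa using dist_le_pi_dist v w j

/-- The sphere in `ℝ^{k+1}` has finite `k`-dimensional Hausdorff measure. -/
theorem hausdorffMeasure_sphere_lt_top (k : ℕ) {R : ℝ} (hR : 0 < R) :
    μH[(k : ℝ)] (Metric.sphere (0 : EuclideanSpace ℝ (Fin (k + 1))) R) < ⊤ := by
  let face : Fin (k + 1) → ℝ → (Fin k → ℝ) → EuclideanSpace ℝ (Fin (k + 1)) :=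
    fun i s v => WithLp.toLp 2 (i.insertNth (α := fun _ => ℝ) s v)
  let proj : EuclideanSpace ℝ (Fin (k + 1)) → EuclideanSpace ℝ (Fin (k + 1)) :=
    fun y => (R / ‖y‖) • y
  let s : Bool → ℝ := fun b => if b then 1 else -1
  have hcover : Metric.sphere (0 : EuclideanSpace ℝ (Fin (k + 1))) R ⊆
      ⋃ p : Fin (k + 1) × Bool, (proj ∘ face p.1 (s p.2)) '' Set.Icc (-1) 1 := by
    intro u hu
    have hu' : ‖u‖ = R := by simpa using hu
    obtain ⟨i, hi⟩ := Finite.exists_max (fun j => |u j|)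
    have hM : 0 < |u i| := by
      by_contra h
      have hz : ∀ j, u j = 0 := fun j =>
        abs_eq_zero.1 (le_antisymm ((hi j).trans (not_lt.1 h)) (abs_nonneg _))
      have : u = 0 := by ext j; simp [hz j]
      rw [this, norm_zero] at hu'
      linarith
    have hface : ∃ b, s b = u i / |u i| := by
      rcases lt_or_gt_of_ne (abs_pos.1 hM) with h | h
      · exact ⟨false, by simp [s, abs_of_neg h, div_neg, div_self h.ne]⟩
      · exact ⟨true, by simp [s, abs_of_pos h, div_self h.ne']⟩
    obtain ⟨b, hb⟩ := hface
    refine Set.mem_iUnion.2 ⟨(i, b), fun j => u (i.succAbove j) / |u i|, ?_, ?_⟩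
    · have h : ∀ j, |u (i.succAbove j) / (|u i|)| ≤ 1 := fun j => by
        rw [abs_div, abs_abs, div_le_one hM]
        exact hi _
      exact ⟨fun j => (abs_le.1 (h j)).1, fun j => (abs_le.1 (h j)).2⟩
    · have hf : face i (s b) (fun j => u (i.succAbove j) / |u i|) = |u i|⁻¹ • u := by
        ext j
        refine Fin.succAboveCases i ?_ (fun j => ?_) j
        · simp [face, hb, div_eq_inv_mul]
        · simp [face, div_eq_inv_mul]
      simp only [Function.comp, proj, hf, norm_smul, norm_inv, Real.norm_eq_abs, abs_abs, hu']
      rw [smul_smul]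
      convert one_smul ℝ u using 2
      field_simp
  have himage : ∀ p : Fin (k + 1) × Bool,
      μH[(k : ℝ)] ((proj ∘ face p.1 (s p.2)) '' Set.Icc (-1) 1) < ⊤ := by
    rintro ⟨i, b⟩
    have hface := (PiLp.lipschitzWith_toLp 2 (fun _ : Fin (k + 1) => ℝ)).comp
      (lipschitzWith_insertNth i (s b))
    have hnorm : ∀ v, 1 ≤ ‖face i (s b) v‖ := fun v => by
      have := PiLp.norm_apply_le (face i (s b) v) i
      have h1 : ‖face i (s b) v i‖ = 1 := by cases b <;> simp [face, s]
      linarith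
    have hproj : LipschitzOnWith (2 * R.toNNReal) proj {y | 1 ≤ ‖y‖} := by
      refine LipschitzOnWith.of_dist_le_mul fun y hy z hz => ?_
      rw [dist_eq_norm, dist_eq_norm]
      simpa [hR.le] using norm_radial_sub_le hR.le hy hz
    have hcomp := hproj.comp (hface.lipschitzOnWith (s := Set.Icc (-1) 1)) (fun v _ => hnorm v)
    refine (hcomp.hausdorffMeasure_image_le k.cast_nonneg).trans_lt ?_
    have hvol : μH[(k : ℝ)] (Set.Icc (-1 : Fin k → ℝ) 1) < ⊤ := by
      have := hausdorffMeasure_pi_real (ι := Fin k)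
      rw [Fintype.card_fin] at this
      rw [this]
      exact isCompact_Icc.measure_lt_top
    exact ENNReal.mul_lt_top
      (ENNReal.rpow_lt_top_of_nonneg k.cast_nonneg ENNReal.coe_ne_top) hvol
  refine (measure_mono hcover).trans_lt ((measure_iUnion_le _).trans_lt ?_)
  rw [tsum_fintype]
  exact ENNReal.sum_lt_top.2 fun p _ => himage p

/-- The sphere in `ℝ^{k+1}` has positive `k`-dimensional Hausdorff measure. -/
theorem hausdorffMeasure_sphere_pos (k : ℕ) {R : ℝ} (hR : 0 < R) :
    0 < μH[(k : ℝ)] (Metric.sphere (0 : EuclideanSpace ℝ (Fin (k + 1))) R) := by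
  let f : EuclideanSpace ℝ (Fin (k + 1)) → (Fin k → ℝ) := fun y j => y j.succ
  have hf : LipschitzWith 1 f := by
    refine LipschitzWith.of_dist_le_mul fun y z => ?_
    rw [NNReal.coe_one, one_mul, dist_pi_le_iff dist_nonneg]
    intro j
    have := PiLp.norm_apply_le (y - z) j.succ
    rwa [dist_eq_norm, dist_eq_norm]
  let U : Set (Fin k → ℝ) := {v | ∑ j, v j ^ 2 < R ^ 2}
  have hU : IsOpen U := isOpen_lt (by fun_prop) continuous_const
  have hUne : U.Nonempty := ⟨0, by simp [U]; positivity⟩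
  have hsub : U ⊆ f '' Metric.sphere 0 R := by
    intro v hv
    refine ⟨WithLp.toLp 2 (Fin.cons (Real.sqrt (R ^ 2 - ∑ j, v j ^ 2)) v), ?_, ?_⟩
    · rw [mem_sphere_zero_iff_norm, EuclideanSpace.norm_eq, Fin.sum_univ_succ]
      have : 0 ≤ R ^ 2 - ∑ j, v j ^ 2 := sub_nonneg.2 (le_of_lt hv)
      simp [Real.sq_sqrt this, hR.le]
    · ext j; simp [f]
  have hvol : 0 < μH[(k : ℝ)] U := by
    have := hausdorffMeasure_pi_real (ι := Fin k)
    rw [Fintype.card_fin] at this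
    rw [this]
    exact hU.measure_pos _ hUne
  refine (hvol.trans_le (measure_mono hsub)).trans_le ?_
  simpa using hf.hausdorffMeasure_image_le k.cast_nonneg (Metric.sphere 0 R)

/-- If an involution `φ` of `S` inverts `w` and scales distances by at most `√(w y * w z)`, then
it transforms the `k`-dimensional measure with density at most `w ^ k`. -/
theorem lintegral_rpow_le_of_conformal {E : Type*} [MetricSpace E] [MeasurableSpace E]
    [BorelSpace E] {S : Set E} (hS : MeasurableSet S) {w : E → ℝ} (hw : Measurable w)
    (hpos : ∀ y ∈ S, 0 < w y) {φ : E → E} (hφS : Set.MapsTo φ S S)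
    (hφφ : ∀ y ∈ S, φ (φ y) = y) (hφw : ∀ y ∈ S, w (φ y) = (w y)⁻¹)
    (hφ : ∀ y ∈ S, ∀ z ∈ S, dist (φ y) (φ z) ≤ √(w y * w z) * dist y z)
    {k : ℝ} (hk : 0 ≤ k) (l : ℝ) :
    ∫⁻ y in S, ENNReal.ofReal (w y ^ l) ∂μH[k] ≤
      ∫⁻ y in S, ENNReal.ofReal (w y ^ (k - l)) ∂μH[k] := by
  have hexp : ∀ y ∈ S, ∀ a : ℝ, w y ^ a = Real.exp (a * Real.log (w y)) := fun y hy a => by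
    rw [Real.rpow_def_of_pos (hpos y hy), mul_comm]
  have hlog : Measurable fun y => Real.log (w y) := hw.log
  have slices : ∀ (g : E → ℝ) (_ : Measurable g) (h : E → ENNReal),
      ∫⁻ y in S, h y ∂μH[k] = ∑' n : ℤ, ∫⁻ y in S ∩ {y | ⌊g y⌋ = n}, h y ∂μH[k] := by
    intro g hg h
    rw [← lintegral_iUnion]
    · congr 2
      ext y; simp
    · exact fun n => hS.inter (hg.floor (measurableSet_singleton n))
    · intro m n hmn
      refine Set.disjoint_left.2 fun y hy hy' => hmn ?_
      exact hy.2.symm.trans hy'.2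
  have approx : ∀ ε : ℝ, 0 < ε →
      ∫⁻ y in S, ENNReal.ofReal (w y ^ l) ∂μH[k] ≤
        ENNReal.ofReal (Real.exp ((|l| + |k - l|) * ε)) *
          ∫⁻ y in S, ENNReal.ofReal (w y ^ (k - l)) ∂μH[k] := by
    intro ε hε
    have hm : Measurable fun y => Real.log (w y) / ε := hlog.div_const ε
    have hm' : Measurable fun y => -Real.log (w y) / ε := hlog.neg.div_const ε
    rw [slices (fun y => Real.log (w y) / ε) hm, slices (fun y => -Real.log (w y) / ε) hm',
      ← ENNReal.tsum_mul_left]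
    refine ENNReal.tsum_le_tsum fun n => ?_
    set T := S ∩ {y | ⌊Real.log (w y) / ε⌋ = n}
    set A := S ∩ {y | ⌊-Real.log (w y) / ε⌋ = n}
    have hT : MeasurableSet T := hS.inter (hm.floor (measurableSet_singleton n))
    have hA : MeasurableSet A := hS.inter (hm'.floor (measurableSet_singleton n))
    have hTb : ∀ y ∈ T, n * ε ≤ Real.log (w y) ∧ Real.log (w y) < (n + 1) * ε := by
      rintro y ⟨-, hy⟩
      have := Int.floor_eq_iff.1 hy
      rwa [le_div_iff₀ hε, div_lt_iff₀ hε] at this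
    have hAb : ∀ y ∈ A, n * ε ≤ -Real.log (w y) ∧ -Real.log (w y) < (n + 1) * ε := by
      rintro y ⟨-, hy⟩
      have := Int.floor_eq_iff.1 hy
      rwa [le_div_iff₀ hε, div_lt_iff₀ hε] at this
    have hTA : T ⊆ φ '' A := by
      rintro y ⟨hyS, hy⟩
      refine ⟨φ y, ⟨hφS hyS, ?_⟩, hφφ y hyS⟩
      simpa [hφw y hyS, Real.log_inv] using hy
    have hwA : ∀ y ∈ A, w y ≤ Real.exp (-(n * ε)) := fun y hy => by
      rw [← Real.log_le_iff_le_exp (hpos y hy.1)]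
      linarith [(hAb y hy).1]
    have hlip : LipschitzOnWith (Real.exp (-(n * ε))).toNNReal φ A := by
      refine LipschitzOnWith.of_dist_le_mul fun y hy z hz => (hφ y hy.1 z hz.1).trans ?_
      rw [Real.coe_toNNReal _ (Real.exp_pos _).le]
      gcongr
      rw [Real.sqrt_le_left (Real.exp_pos _).le, sq]
      exact mul_le_mul (hwA y hy) (hwA z hz) (hpos z hz.1).le (Real.exp_pos _).le
    have hμ : μH[k] T ≤ ENNReal.ofReal (Real.exp (-(n * ε) * k)) * μH[k] A := by
      refine (measure_mono hTA).trans ((hlip.hausdorffMeasure_image_le hk).trans_eq ?_)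
      congr 1
      rw [← ENNReal.ofReal.eq_1, ENNReal.ofReal_rpow_of_pos (Real.exp_pos _), ← Real.exp_mul]
    calc ∫⁻ y in T, ENNReal.ofReal (w y ^ l) ∂μH[k]
        ≤ ∫⁻ _ in T, ENNReal.ofReal (Real.exp (l * (n * ε) + |l| * ε)) ∂μH[k] := by
          refine setLIntegral_mono' hT fun y hy => ENNReal.ofReal_le_ofReal ?_
          rw [hexp y hy.1, Real.exp_le_exp]
          obtain ⟨h1, h2⟩ := hTb y hy
          have : l * (Real.log (w y) - n * ε) ≤ |l| * ε :=
            mul_le_mul (le_abs_self l) (by linarith) (by linarith) (abs_nonneg l)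
          linarith
      _ ≤ ENNReal.ofReal (Real.exp (l * (n * ε) + |l| * ε)) *
            (ENNReal.ofReal (Real.exp (-(n * ε) * k)) * μH[k] A) := by
          rw [setLIntegral_const]
          gcongr
      _ = ENNReal.ofReal (Real.exp ((|l| + |k - l|) * ε)) *
            ∫⁻ _ in A, ENNReal.ofReal
              (Real.exp (-((k - l) * (n * ε)) - |k - l| * ε)) ∂μH[k] := by
          rw [setLIntegral_const, ← mul_assoc (ENNReal.ofReal _), ← mul_assoc (ENNReal.ofReal _),
            ← ENNReal.ofReal_mul (by positivity), ← ENNReal.ofReal_mul (by positivity),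
            ← Real.exp_add, ← Real.exp_add]
          congr 3
          ring
      _ ≤ _ := by
          refine mul_le_mul_right ?_ _
          refine setLIntegral_mono' hA fun y hy => ENNReal.ofReal_le_ofReal ?_
          rw [hexp y hy.1, Real.exp_le_exp]
          obtain ⟨h1, h2⟩ := hAb y hy
          have : (k - l) * (-Real.log (w y) - n * ε) ≤ |k - l| * ε :=
            mul_le_mul (le_abs_self _) (by linarith) (by linarith) (abs_nonneg _)
          linarith
  have hlim : Filter.Tendsto (fun ε : ℝ => ENNReal.ofReal (Real.exp ((|l| + |k - l|) * ε)) *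
      ∫⁻ y in S, ENNReal.ofReal (w y ^ (k - l)) ∂μH[k]) (nhdsWithin 0 (Set.Ioi 0))
      (nhds (1 * ∫⁻ y in S, ENNReal.ofReal (w y ^ (k - l)) ∂μH[k])) := by
    refine ENNReal.Tendsto.mul_const (tendsto_nhdsWithin_of_tendsto_nhds ?_) (by simp)
    have : Continuous fun ε : ℝ => ENNReal.ofReal (Real.exp ((|l| + |k - l|) * ε)) :=
      ENNReal.continuous_ofReal.comp (by fun_prop)
    simpa using this.tendsto 0
  rw [one_mul] at hlim
  exact ge_of_tendsto hlim (Filter.eventually_of_mem self_mem_nhdsWithin approx)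

/-- The inversion-type map sending `y` to the second intersection of the line through `x` and `y`
with the sphere of radius `R` containing `y`. -/
noncomputable def secondIntersection {n : ℕ} (R : ℝ) (x y : EuclideanSpace ℝ (Fin n)) :
    EuclideanSpace ℝ (Fin n) :=
  x + ((‖x‖ ^ 2 - R ^ 2) / ‖y - x‖ ^ 2) • (y - x)

section Sphere

variable {n : ℕ} {R : ℝ} {x y z : EuclideanSpace ℝ (Fin n)}

theorem norm_sub_pos_of_mem_sphere (hx : ‖x‖ ≠ R) (hy : y ∈ Metric.sphere 0 R) :
    0 < ‖y - x‖ := by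
  rw [norm_pos_iff, sub_ne_zero]
  rintro rfl
  exact hx (by simpa using hy)

theorem sq_norm_sub_sq_ne_zero (hR : 0 < R) (hx : ‖x‖ ≠ R) : ‖x‖ ^ 2 - R ^ 2 ≠ 0 := by
  rw [sub_ne_zero, Ne, sq_eq_sq₀ (norm_nonneg _) hR.le]
  exact hx

theorem sRatio_pos (hR : 0 < R) (hx : ‖x‖ ≠ R) (hy : y ∈ Metric.sphere 0 R) :
    0 < sRatio R x y := by
  have := norm_sub_pos_of_mem_sphere hx hy
  rw [norm_sub_rev] at this
  have := abs_pos.2 (sq_norm_sub_sq_ne_zero hR hx)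
  rw [sRatio]
  positivity

theorem measurable_sRatio : Measurable (sRatio R x) := by
  unfold sRatio
  fun_prop

theorem continuousOn_sRatio (hx : ‖x‖ ≠ R) :
    ContinuousOn (sRatio R x) (Metric.sphere 0 R) := by
  unfold sRatio
  refine ContinuousOn.div (by fun_prop) (by fun_prop) fun y hy => ?_
  have := norm_sub_pos_of_mem_sphere hx hy
  rw [norm_sub_rev]
  positivity

theorem secondIntersection_sub :
    secondIntersection R x y - x = ((‖x‖ ^ 2 - R ^ 2) / ‖y - x‖ ^ 2) • (y - x) := by
  simp [secondIntersection]

theorem norm_secondIntersection_sub (hx : ‖x‖ ≠ R) (hy : y ∈ Metric.sphere 0 R) :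
    ‖secondIntersection R x y - x‖ = |‖x‖ ^ 2 - R ^ 2| / ‖y - x‖ := by
  have := norm_sub_pos_of_mem_sphere hx hy
  rw [secondIntersection_sub, norm_smul, Real.norm_eq_abs, abs_div, abs_sq]
  field_simp

theorem secondIntersection_mem_sphere (hR : 0 < R) (hx : ‖x‖ ≠ R)
    (hy : y ∈ Metric.sphere 0 R) : secondIntersection R x y ∈ Metric.sphere 0 R := by
  have hpos := norm_sub_pos_of_mem_sphere hx hy
  have hy' : ‖y‖ = R := by simpa using hy
  rw [mem_sphere_zero_iff_norm, ← sq_eq_sq₀ (norm_nonneg _) hR.le, secondIntersection,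
    norm_add_sq_real, inner_smul_right, norm_smul, mul_pow, Real.norm_eq_abs, sq_abs]
  have h : ‖y‖ ^ 2 = ‖x‖ ^ 2 + 2 * inner ℝ x (y - x) + ‖y - x‖ ^ 2 := by
    rw [← norm_add_sq_real, add_sub_cancel]
  rw [hy'] at h
  have h2 : inner ℝ x (y - x) = (R ^ 2 - ‖x‖ ^ 2 - ‖y - x‖ ^ 2) / 2 := by linarith
  rw [h2]
  field_simp
  ring

theorem secondIntersection_secondIntersection (hR : 0 < R) (hx : ‖x‖ ≠ R)
    (hy : y ∈ Metric.sphere 0 R) :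
    secondIntersection R x (secondIntersection R x y) = y := by
  have hpos := norm_sub_pos_of_mem_sphere hx hy
  have hp := sq_norm_sub_sq_ne_zero hR hx
  rw [secondIntersection, norm_secondIntersection_sub hx hy, secondIntersection_sub, smul_smul,
    div_pow, sq_abs]
  convert add_sub_cancel x y
  convert one_smul ℝ (y - x) using 2
  field_simp

theorem sRatio_secondIntersection (hR : 0 < R) (hx : ‖x‖ ≠ R) (hy : y ∈ Metric.sphere 0 R) :
    sRatio R x (secondIntersection R x y) = (sRatio R x y)⁻¹ := by
  have hpos := norm_sub_pos_of_mem_sphere hx hy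
  have hp := abs_pos.2 (sq_norm_sub_sq_ne_zero hR hx)
  rw [sRatio, sRatio, norm_sub_rev x, norm_secondIntersection_sub hx hy, norm_sub_rev x]
  field_simp

theorem dist_secondIntersection (hx : ‖x‖ ≠ R) (hy : y ∈ Metric.sphere 0 R)
    (hz : z ∈ Metric.sphere 0 R) :
    dist (secondIntersection R x y) (secondIntersection R x z) =
      √(sRatio R x y * sRatio R x z) * dist y z := by
  have hy0 := norm_sub_pos_of_mem_sphere hx hy
  have hz0 := norm_sub_pos_of_mem_sphere hx hz
  have key := dist_div_norm_sq_smul (norm_pos_iff.1 hy0) (norm_pos_iff.1 hz0) 1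
  rw [dist_sub_right] at key
  have hs : √(sRatio R x y * sRatio R x z) =
      |‖x‖ ^ 2 - R ^ 2| * (1 ^ 2 / (‖y - x‖ * ‖z - x‖)) := by
    rw [Real.sqrt_eq_iff_mul_self_eq (by unfold sRatio; positivity) (by positivity), sRatio,
      sRatio, norm_sub_rev x, norm_sub_rev x]
    field_simp
  have hsmul : ∀ u, secondIntersection R x u =
      x + (‖x‖ ^ 2 - R ^ 2) • ((1 / ‖u - x‖) ^ 2 • (u - x)) := fun u => by
    rw [secondIntersection, smul_smul, div_pow, one_pow, mul_one_div]
  rw [hsmul, hsmul, dist_add_left, dist_smul₀, key, hs, Real.norm_eq_abs, mul_assoc]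

theorem sRatio_ne_one_of_inner_nonpos (hR : 0 < R) (hx0 : 0 < ‖x‖) (hx : ‖x‖ ≠ R)
    (hy : y ∈ Metric.sphere 0 R) (hxy : inner ℝ x y ≤ 0) : sRatio R x y ≠ 1 := by
  have hpos := norm_sub_pos_of_mem_sphere hx hy
  have hy' : ‖y‖ = R := by simpa using hy
  rw [norm_sub_rev] at hpos
  rw [sRatio, Ne, div_eq_one_iff_eq (by positivity), norm_sub_sq_real, hy']
  refine ne_of_lt (abs_lt.2 ⟨?_, ?_⟩) <;> nlinarith [sq_pos_of_pos hx0, sq_pos_of_pos hR]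

end Sphere

theorem hausdorffMeasure_sRatio_ne_one_pos {k : ℕ} {R : ℝ} (hR : 0 < R)
    {x : EuclideanSpace ℝ (Fin (k + 1))} (hx0 : 0 < ‖x‖) (hx : ‖x‖ ≠ R) :
    0 < μH[(k : ℝ)] ({y | sRatio R x y ≠ 1} ∩ Metric.sphere 0 R) := by
  set U := {y | sRatio R x y ≠ 1} ∩ Metric.sphere 0 R
  have hcover : Metric.sphere 0 R ⊆ U ∪ IsometryEquiv.neg _ '' U := by
    intro y hy
    rcases le_total (inner ℝ x y) 0 with h | h
    · exact Or.inl ⟨sRatio_ne_one_of_inner_nonpos hR hx0 hx hy h, hy⟩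
    · have hy' : -y ∈ Metric.sphere 0 R := by simpa using hy
      refine Or.inr ⟨-y, ⟨sRatio_ne_one_of_inner_nonpos hR hx0 hx hy' ?_, hy'⟩, by simp⟩
      rw [inner_neg_right]
      linarith
  have h := (hausdorffMeasure_sphere_pos k hR).trans_le
    ((measure_mono hcover).trans (measure_union_le _ _))
  rw [IsometryEquiv.hausdorffMeasure_image] at h
  by_contra h0
  rw [not_lt, nonpos_iff_eq_zero] at h0
  simp [h0] at h

/-- The real function `F(λ) = ∫_{S^k(R)} ω^λ dS_y` is strictly convex, symmetric about
`λ = k/2` (i.e. `F(λ) = F(k − λ)`), attains its unique global minimum at `λ = k/2`,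
and its second derivative equals `∫_{S^k(R)} ω^λ (ln ω)² dS_y > 0` for every `λ`. -/
theorem stmt_19 (k : ℕ) (hk : 1 ≤ k) (R : ℝ) (hR : 0 < R)
    (x : EuclideanSpace ℝ (Fin (k + 1))) (hx0 : 0 < ‖x‖) (hx : ‖x‖ ≠ R)
    (F : ℝ → ℝ)
    (hF : ∀ l : ℝ, F l =
      ∫ y in Metric.sphere (0 : EuclideanSpace ℝ (Fin (k + 1))) R,
        (sRatio R x y) ^ l ∂(μH[(k : ℝ)])) :
    StrictConvexOn ℝ Set.univ F ∧
    (∀ l : ℝ, F l = F (k - l)) ∧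
    (∀ l : ℝ, l ≠ (k : ℝ) / 2 → F ((k : ℝ) / 2) < F l) ∧
    (∀ l : ℝ,
      iteratedDeriv 2 F l =
        ∫ y in Metric.sphere (0 : EuclideanSpace ℝ (Fin (k + 1))) R,
          (sRatio R x y) ^ l * (Real.log (sRatio R x y)) ^ 2 ∂(μH[(k : ℝ)]) ∧
      0 < iteratedDeriv 2 F l) := by
  set S := Metric.sphere (0 : EuclideanSpace ℝ (Fin (k + 1))) R
  have hSm : MeasurableSet S := Metric.isClosed_sphere.measurableSet
  have hpos : ∀ y ∈ S, 0 < sRatio R x y := fun y hy => sRatio_pos hR hx hy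
  have hcont : ∀ l : ℝ, ContinuousOn (fun y => sRatio R x y ^ l) S := fun l =>
    (continuousOn_sRatio hx).rpow_const fun y hy => Or.inl (hpos y hy).ne'
  have hfin := (hausdorffMeasure_sphere_lt_top k hR).ne
  have hint : ∀ l : ℝ, IntegrableOn (fun y => sRatio R x y ^ l) S μH[(k : ℝ)] := fun l =>
    (hcont l).integrableOn_of_subset_isCompact (isCompact_sphere _ _) hSm subset_rfl hfin
  have hexp : ∀ l : ℝ, Set.EqOn (fun y => sRatio R x y ^ l)
      (fun y => Real.exp (l * Real.log (sRatio R x y))) S := fun l y hy => by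
    simp only [Real.rpow_def_of_pos (hpos y hy), mul_comm]
  have hFmgf : F = ProbabilityTheory.mgf (fun y => Real.log (sRatio R x y))
      (μH[(k : ℝ)].restrict S) := by
    ext l
    rw [hF, ProbabilityTheory.mgf]
    exact setIntegral_congr_fun hSm (hexp l)
  have hset : ∀ l : ℝ, l ∈ interior (ProbabilityTheory.integrableExpSet
      (fun y => Real.log (sRatio R x y)) (μH[(k : ℝ)].restrict S)) := by
    have : ProbabilityTheory.integrableExpSet
        (fun y => Real.log (sRatio R x y)) (μH[(k : ℝ)].restrict S) = Set.univ :=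
      Set.eq_univ_of_forall fun l => (hint l).congr_fun (hexp l) hSm
    simp [this]
  have hderiv : ∀ l : ℝ, iteratedDeriv 2 F l =
      ∫ y in S, sRatio R x y ^ l * Real.log (sRatio R x y) ^ 2 ∂μH[(k : ℝ)] := fun l => by
    rw [hFmgf, ProbabilityTheory.iteratedDeriv_mgf (hset l)]
    refine setIntegral_congr_fun hSm fun y hy => ?_
    simp only [Real.rpow_def_of_pos (hpos y hy), mul_comm]
  have hderiv_pos : ∀ l : ℝ, 0 < iteratedDeriv 2 F l := fun l => by
    rw [hderiv, setIntegral_pos_iff_support_of_nonneg_ae]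
    · refine (hausdorffMeasure_sRatio_ne_one_pos hR hx0 hx).trans_le (measure_mono ?_)
      rintro y ⟨hy1, hyS⟩
      have := hpos y hyS
      have hlog := Real.log_ne_zero_of_pos_of_ne_one this hy1
      exact ⟨mul_ne_zero (by positivity) (pow_ne_zero 2 hlog), hyS⟩
    · refine (ae_restrict_iff' hSm).2 (Filter.Eventually.of_forall fun y hy => ?_)
      have := hpos y hy
      exact mul_nonneg (by positivity) (sq_nonneg _)
    · refine ContinuousOn.integrableOn_of_subset_isCompact ?_ (isCompact_sphere _ _) hSm
        subset_rfl hfin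
      exact (hcont l).mul (((continuousOn_sRatio hx).log fun y hy => (hpos y hy).ne').pow 2)
  have hconv : StrictConvexOn ℝ Set.univ F := by
    refine strictConvexOn_univ_of_deriv2_pos ?_ fun l => ?_
    · rw [hFmgf]
      exact continuous_iff_continuousAt.2 fun l =>
        (ProbabilityTheory.differentiableAt_mgf (hset l)).continuousAt
    · rw [← iteratedDeriv_eq_iterate]
      exact hderiv_pos l
  have hle : ∀ l : ℝ, F l ≤ F (k - l) := fun l => by
    have h := lintegral_rpow_le_of_conformal hSm measurable_sRatio hpos
      (fun y hy => secondIntersection_mem_sphere hR hx hy)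
      (fun y hy => secondIntersection_secondIntersection hR hx hy)
      (fun y hy => sRatio_secondIntersection hR hx hy)
      (fun y hy z hz => (dist_secondIntersection hx hy hz).le) (k.cast_nonneg (α := ℝ)) l
    have hnn : ∀ a : ℝ, 0 ≤ᵐ[μH[(k : ℝ)].restrict S] fun y => sRatio R x y ^ a := fun a =>
      (ae_restrict_iff' hSm).2 (Filter.Eventually.of_forall fun y hy =>
        Real.rpow_nonneg (hpos y hy).le a)
    rw [← ofReal_integral_eq_lintegral_ofReal (hint _) (hnn _),
      ← ofReal_integral_eq_lintegral_ofReal (hint _) (hnn _),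
      ENNReal.ofReal_le_ofReal_iff (integral_nonneg_of_ae (hnn _))] at h
    rwa [hF, hF]
  have hsymm : ∀ l : ℝ, F l = F (k - l) := fun l =>
    le_antisymm (hle l) (by simpa using hle (k - l))
  refine ⟨hconv, hsymm, fun l hl => ?_, fun l => ⟨hderiv l, hderiv_pos l⟩⟩
  have hne : l ≠ k - l := fun h => hl (by linarith)
  have h := hconv.2 (Set.mem_univ l) (Set.mem_univ (k - l)) hne
    (by norm_num : (0 : ℝ) < 1 / 2) (by norm_num : (0 : ℝ) < 1 / 2) (by norm_num)
  rw [← hsymm l] at h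
  simp only [smul_eq_mul] at h
  rw [show 1 / 2 * l + 1 / 2 * (k - l) = (k : ℝ) / 2 by ring] at h
  linarith
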